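/- Fix k ∈ ℕ and let F_k be the set of minimal excluded minors for the class of finite undirected graphs of entanglement at most k, i.e. the graphs H with Ent(H) > k such that every proper minor G of H satisfies Ent(G) ≤ k. Then every graph in F_k has entanglement exactly k + 1. -/

import Mathlib

/-!
The entanglement game `Ent(G,k)` on a graph with adjacency relation
`E : V → V → Prop` is played by Robber against `k` cops.  Positions are
`(v, C, P)` with `v : V`, `C : Finset V` with `C.card ≤ k`, and
`P ∈ {Cops, Robber}`.  Initially Robber chooses `v₀` and moves to
`(v₀, ∅, Cops)`.  From `(v, C, Cops)`, Cops may skip, add a cop on `v`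
(if at most `k` cops are then placed), or move a placed cop to `v`; from
`(v, C, Robber)`, Robber moves along an edge to a vertex free of cops.
Every finite play is a win for Cops, so "Cops have a winning strategy from
`(v, C, Cops)`" is the inductive predicate `EntCopsWinFrom`.  The
entanglement of the graph is the least `k` such that Cops have a winning
strategy in `Ent(G,k)` (it is at most the number of vertices).
-/

variable {V : Type*} [DecidableEq V]

/-- A legal Cops move in the game `Ent(G,k)`: from position `(v, C, Cops)`
Cops may go to `(v, C', Robber)` where `C'` is `C` (skip), `C ∪ {v}` provided
at most `k` cops are used (add), or `(C \ {x}) ∪ {v}` for some `x ∈ C`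
(move a placed cop). -/
def EntCopsMove (k : ℕ) (v : V) (C C' : Finset V) : Prop :=
  C' = C ∨ (C' = insert v C ∧ (insert v C).card ≤ k) ∨
    ∃ x ∈ C, C' = insert v (C.erase x)

/-- Cops have a winning strategy in `Ent(G,k)` from position `(v, C, Cops)`. -/
inductive EntCopsWinFrom (E : V → V → Prop) (k : ℕ) : V → Finset V → Prop
  | step (v : V) (C C' : Finset V) (hmove : EntCopsMove k v C C')
      (h : ∀ v', E v v' → v' ∉ C' → EntCopsWinFrom E k v' C') :
      EntCopsWinFrom E k v C

/-- Cops have a winning strategy in the game `Ent(G,k)`. -/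
def EntCopsWin (E : V → V → Prop) (k : ℕ) : Prop :=
  ∀ v : V, EntCopsWinFrom E k v ∅

/-- The entanglement of a graph: the least number `k` of cops such that Cops
have a winning strategy in the game `Ent(G,k)`. -/
noncomputable def entanglement (E : V → V → Prop) : ℕ :=
  sInf {k | EntCopsWin E k}

universe u

/-- A finite undirected graph, bundled with its (finite, decidable) vertex
type. -/
structure FinGraph : Type (u + 1) where
  V : Type u
  [instFintype : Fintype V]
  [instDecEq : DecidableEq V]
  G : SimpleGraph V

attribute [instance] FinGraph.instFintype FinGraph.instDecEq

/-- The entanglement of a bundled finite graph. -/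
noncomputable def FinGraph.ent (X : FinGraph) : ℕ :=
  entanglement X.G.Adj

/-- `X` is obtained from `Y` by deleting one edge. -/
def FinGraph.IsEdgeDeletion (X Y : FinGraph) : Prop :=
  ∃ a b : Y.V, Y.G.Adj a b ∧ Nonempty (X.G ≃g Y.G.deleteEdges {s(a, b)})

/-- `X` is obtained from `Y` by contracting one edge `ab` to a new vertex `z`
which inherits all the neighbours of `a` and `b`; the contraction is
witnessed by the surjection `f` identifying exactly `a` and `b`. -/
def FinGraph.IsEdgeContraction (X Y : FinGraph) : Prop :=
  ∃ (a b : Y.V) (z : X.V) (f : Y.V → X.V),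
    Y.G.Adj a b ∧ f a = z ∧ f b = z ∧ Function.Surjective f ∧
    (∀ u v : Y.V, u ≠ v → f u = f v → (u = a ∧ v = b) ∨ (u = b ∧ v = a)) ∧
    (∀ x y : X.V,
      X.G.Adj x y ↔ x ≠ y ∧ ∃ u v : Y.V, f u = x ∧ f v = y ∧ Y.G.Adj u v)

/-- `X` is obtained from `Y` by deleting one isolated vertex. -/
def FinGraph.IsIsolatedVertexDeletion (X Y : FinGraph) : Prop :=
  ∃ v : Y.V, (∀ w, ¬ Y.G.Adj v w) ∧
    Nonempty (X.G ≃g Y.G.induce ({v}ᶜ : Set Y.V))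

/-- `X` is a direct minor of `Y`: it is obtained from `Y` by a single
operation of edge deletion, edge contraction, or deletion of an isolated
vertex. -/
def FinGraph.DirectMinor (X Y : FinGraph) : Prop :=
  X.IsEdgeDeletion Y ∨ X.IsEdgeContraction Y ∨ X.IsIsolatedVertexDeletion Y

/-- `X` is a minor of `Y`: it is obtained from `Y` by successive edge
deletions, edge contractions and deletions of isolated vertices. -/
def FinGraph.IsMinor (X Y : FinGraph) : Prop :=
  Relation.ReflTransGen FinGraph.DirectMinor X Y

/-- `X` is a proper minor of `Y`: a minor obtained by at least one
operation. -/
def FinGraph.ProperMinor (X Y : FinGraph) : Prop :=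
  Relation.TransGen FinGraph.DirectMinor X Y

lemma EntCopsMove.card_le {k : ℕ} {v : V} {C C' : Finset V} (h : EntCopsMove k v C C')
    (hC : C.card ≤ k) : C'.card ≤ k := by
  rcases h with rfl | ⟨rfl, h⟩ | ⟨x, hx, rfl⟩
  · exact hC
  · exact h
  · calc (insert v (C.erase x)).card ≤ (C.erase x).card + 1 := Finset.card_insert_le _ _
      _ = C.card := Finset.card_erase_add_one hx
      _ ≤ k := hC

/-- A move of `k` cops off the vertex `b` can be imitated by `k + 1` cops, one of which stays
on `b`, keeping all the vertices covered by the original cops covered. -/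
lemma EntCopsMove.exists_superset {k : ℕ} {b v : V} {C C' D : Finset V}
    (h : EntCopsMove k v C C') (hv : v ≠ b) (hbC : b ∉ C) (hbD : b ∈ D) (hCD : C ⊆ D)
    (hD : D.card ≤ k + 1) :
    ∃ D', EntCopsMove (k + 1) v D D' ∧ b ∉ C' ∧ b ∈ D' ∧ C' ⊆ D' := by
  rcases h with rfl | ⟨rfl, hk⟩ | ⟨x, hx, rfl⟩
  · exact ⟨D, .inl rfl, hbC, hbD, hCD⟩
  · have hb : b ∉ insert v C := by simp [hbC, hv.symm]
    by_cases hvD : v ∈ D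
    · exact ⟨D, .inl rfl, hb, hbD, Finset.insert_subset hvD hCD⟩
    by_cases hlt : D.card ≤ k
    · exact ⟨insert v D, .inr (.inl ⟨rfl, (Finset.card_insert_le _ _).trans (by omega)⟩), hb,
        Finset.mem_insert_of_mem hbD, Finset.insert_subset_insert v hCD⟩
    have hvC : v ∉ C := fun h => hvD (hCD h)
    rw [Finset.card_insert_of_notMem hvC] at hk
    obtain ⟨x, hxD, hx⟩ : ∃ x ∈ D, x ∉ insert b C :=
      Finset.exists_mem_notMem_of_card_lt_card
        ((Finset.card_insert_le b C).trans_lt (by omega))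
    rw [Finset.mem_insert, not_or] at hx
    refine ⟨insert v (D.erase x), .inr (.inr ⟨x, hxD, rfl⟩), hb,
      Finset.mem_insert_of_mem (Finset.mem_erase.2 ⟨Ne.symm hx.1, hbD⟩),
      Finset.insert_subset_insert v (Finset.subset_erase.2 ⟨hCD, hx.2⟩)⟩
  · have hxb : b ≠ x := fun h => hbC (h ▸ hx)
    exact ⟨insert v (D.erase x), .inr (.inr ⟨x, hCD hx, rfl⟩), by simp [hbC, hv.symm],
      Finset.mem_insert_of_mem (Finset.mem_erase.2 ⟨hxb, hbD⟩),
      Finset.insert_subset_insert v (Finset.erase_subset_erase x hCD)⟩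

/-- If `E` and `E'` agree off the vertex `b`, then an additional cop kept on `b` lets Cops use
on `E` a winning strategy for `E'`, whatever the superfluous cops already placed. -/
lemma EntCopsWinFrom.of_mem {E E' : V → V → Prop} {k : ℕ} {b v : V} {C : Finset V}
    (hE : ∀ x y, x ≠ b → y ≠ b → E x y → E' x y) (h : EntCopsWinFrom E' k v C) :
    ∀ D : Finset V, v ≠ b → b ∉ C → b ∈ D → C ⊆ D → D.card ≤ k + 1 →
      EntCopsWinFrom E (k + 1) v D := by
  induction h with
  | step v C C' hmove _ ih =>
    intro D hv hbC hbD hCD hD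
    obtain ⟨D', hD', hbC', hbD', hCD'⟩ := hmove.exists_superset hv hbC hbD hCD hD
    refine .step v D D' hD' fun w hw hwD => ?_
    have hwb : w ≠ b := fun h => hwD (h ▸ hbD')
    exact ih w (hE v w hv hwb hw) (fun h => hwD (hCD' h)) D' hwb hbC' hbD' hCD'
      (hD'.card_le hD)

/-- Cops may occupy the current vertex `b` for good and afterwards restart a strategy for `E'`. -/
lemma EntCopsWin.winFrom_succ {E E' : V → V → Prop} {k : ℕ} (h : EntCopsWin E' k) (b : V)
    (hE : ∀ x y, x ≠ b → y ≠ b → E x y → E' x y) {C : Finset V} (hC : C.card ≤ k) :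
    EntCopsWinFrom E (k + 1) b C := by
  have hcard : (insert b C).card ≤ k + 1 := (Finset.card_insert_le _ _).trans (by omega)
  refine .step b C (insert b C) (.inr (.inl ⟨rfl, hcard⟩)) fun w _ hw => ?_
  exact (h w).of_mem hE (insert b C) (fun e => hw (e ▸ Finset.mem_insert_self b C))
    (Finset.notMem_empty b) (Finset.mem_insert_self b C) (Finset.empty_subset _) hcard

lemma EntCopsWinFrom.succ_of_edge {E E' : V → V → Prop} {k : ℕ} {a b v : V} {C : Finset V}
    (hE : ∀ x y, E x y → E' x y ∨ s(x, y) = s(a, b)) (hwin : EntCopsWin E' k)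
    (h : EntCopsWinFrom E' k v C) (hC : C.card ≤ k) : EntCopsWinFrom E (k + 1) v C := by
  induction h with
  | step v C C' hmove _ ih =>
    have hC' := hmove.card_le hC
    refine .step v C C' ?_ fun w hw hwC => ?_
    · rcases hmove with h | ⟨h, hk⟩ | h
      · exact .inl h
      · exact .inr (.inl ⟨h, hk.trans k.le_succ⟩)
      · exact .inr (.inr h)
    rcases hE v w hw with h | h
    · exact ih w h hwC hC'
    · refine hwin.winFrom_succ w (fun x y hx hy hxy => (hE x y hxy).resolve_right fun e => ?_) hC'
      have hmem : w ∈ s(x, y) := by rw [e, ← h]; exact Sym2.mem_mk_right v w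
      rcases Sym2.mem_iff.1 hmem with rfl | rfl
      · exact hx rfl
      · exact hy rfl

/-- Adding one undirected edge requires at most one additional cop. -/
lemma EntCopsWin.succ_of_edge {E E' : V → V → Prop} {k : ℕ} {a b : V}
    (hE : ∀ x y, E x y → E' x y ∨ s(x, y) = s(a, b)) (h : EntCopsWin E' k) :
    EntCopsWin E (k + 1) :=
  fun v => (h v).succ_of_edge hE h (by simp)

lemma entCopsWinFrom_card [Fintype V] (E : V → V → Prop) {v : V} {C : Finset V} (hv : v ∉ C) :
    EntCopsWinFrom E (Fintype.card V) v C :=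
  .step v C (insert v C) (.inr (.inl ⟨rfl, Finset.card_le_univ _⟩))
    fun _ _ hw => entCopsWinFrom_card E hw
termination_by Fintype.card V - C.card
decreasing_by
  have h := Finset.card_le_univ (insert v C)
  rw [Finset.card_insert_of_notMem hv] at h ⊢
  omega

lemma entCopsWin_entanglement [Fintype V] (E : V → V → Prop) :
    EntCopsWin E (entanglement E) :=
  Nat.sInf_mem (s := {k | EntCopsWin E k})
    ⟨Fintype.card V, fun v => entCopsWinFrom_card E (Finset.notMem_empty v)⟩

lemma entanglement_eq_zero {E : V → V → Prop} (hE : ∀ a b, ¬ E a b) : entanglement E = 0 :=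
  Nat.sInf_eq_zero.2 <| .inl fun v => .step v ∅ ∅ (.inl rfl) fun w hw => (hE v w hw).elim

/-- Every minimal excluded minor for the class of finite undirected graphs of
entanglement at most `k` — i.e. every graph `H` with `Ent(H) > k` all of whose
proper minors `G` satisfy `Ent(G) ≤ k` — has entanglement exactly `k + 1`. -/
theorem ent_of_minimal_excluded_minor (k : ℕ) (H : FinGraph)
    (hH : H ∈ {H : FinGraph | k < H.ent ∧ ∀ G : FinGraph, G.ProperMinor H → G.ent ≤ k}) :
    H.ent = k + 1 := by
  obtain ⟨hlt, hminor⟩ := hH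
  obtain ⟨a, b, hab⟩ : ∃ a b, H.G.Adj a b := by
    by_contra! hE
    have : H.ent = 0 := entanglement_eq_zero hE
    omega
  have hle := hminor ⟨H.V, H.G.deleteEdges {s(a, b)}⟩
    (.single (.inl ⟨a, b, hab, ⟨SimpleGraph.Iso.refl⟩⟩))
  have hwin := (entCopsWin_entanglement (H.G.deleteEdges {s(a, b)}).Adj).succ_of_edge
    (E := H.G.Adj) (a := a) (b := b) fun x y hxy => by
      rw [SimpleGraph.deleteEdges_adj, Set.mem_singleton_iff]
      tauto
  have hent : H.ent ≤ FinGraph.ent ⟨H.V, H.G.deleteEdges {s(a, b)}⟩ + 1 := Nat.sInf_le hwin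
  omega
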